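/- Given finite alphabets, for any random variables with Markov chain Z − X − Y − U where U takes values in an arbitrary finite set, there exists U' taking values in a set of cardinality at most |Y| + 2 with Z − X − Y − U' such that I(Z;U') = I(Z;U), I(Y;U') = I(Y;U), and I(X;U') = I(X;U). -/

import Mathlib

open scoped BigOperators Classical

noncomputable section

/-- A probability distribution on a finite sample space. -/
structure FinProb (Ω : Type*) [Fintype Ω] where
  p : Ω → ℝ
  nonneg : ∀ ω, 0 ≤ p ω
  sum_one : ∑ ω, p ω = 1

variable {Ω : Type*} [Fintype Ω]

/-- Probability of an event. -/
def FinProb.pr (μ : FinProb Ω) (E : Set Ω) : ℝ :=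
  ∑ ω, if ω ∈ E then μ.p ω else 0

/-- Distribution (pmf) of a random variable. -/
def dist {A : Type*} [Fintype A] (μ : FinProb Ω) (X : Ω → A) (a : A) : ℝ :=
  ∑ ω, if X ω = a then μ.p ω else 0

/-- Shannon entropy (in bits) of a finite-valued random variable. -/
def Hent {A : Type*} [Fintype A] (μ : FinProb Ω) (X : Ω → A) : ℝ :=
  ∑ a, -(dist μ X a * Real.logb 2 (dist μ X a))

/-- Conditional entropy H(X|Y) (in bits). -/
def Hcond {A B : Type*} [Fintype A] [Fintype B] (μ : FinProb Ω) (X : Ω → A) (Y : Ω → B) : ℝ :=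
  Hent μ (fun ω => (X ω, Y ω)) - Hent μ Y

/-- Mutual information I(X;Y) (in bits). -/
def MuI {A B : Type*} [Fintype A] [Fintype B] (μ : FinProb Ω) (X : Ω → A) (Y : Ω → B) : ℝ :=
  Hent μ X + Hent μ Y - Hent μ (fun ω => (X ω, Y ω))

/-- Independence of two random variables. -/
def IndepRV {A B : Type*} [Fintype A] [Fintype B] (μ : FinProb Ω) (X : Ω → A) (Y : Ω → B) : Prop :=
  ∀ a b, dist μ (fun ω => (X ω, Y ω)) (a, b) = dist μ X a * dist μ Y b

/-- A random variable is uniformly distributed. -/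
def Uniform {A : Type*} [Fintype A] (μ : FinProb Ω) (X : Ω → A) : Prop :=
  ∀ a, dist μ X a = 1 / (Fintype.card A : ℝ)

/-- Markov chain X − Y − Z: X and Z conditionally independent given Y. -/
def Markov {A B C : Type*} [Fintype A] [Fintype B] [Fintype C]
    (μ : FinProb Ω) (X : Ω → A) (Y : Ω → B) (Z : Ω → C) : Prop :=
  ∀ a b c, dist μ (fun ω => (X ω, Y ω, Z ω)) (a, b, c) * dist μ Y b =
    dist μ (fun ω => (X ω, Y ω)) (a, b) * dist μ (fun ω => (Y ω, Z ω)) (b, c)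

/-- Markov chain Z − X − Y − U of length four. -/
def Markov4 {A B C D : Type*} [Fintype A] [Fintype B] [Fintype C] [Fintype D]
    (μ : FinProb Ω) (Z : Ω → A) (X : Ω → B) (Y : Ω → C) (U : Ω → D) : Prop :=
  Markov μ Z X (fun ω => (Y ω, U ω)) ∧ Markov μ (fun ω => (Z ω, X ω)) Y U

/-- The process `Y` is i.i.d. -/
def IID {n : ℕ} {A : Type*} [Fintype A] (μ : FinProb Ω) (Y : Fin n → Ω → A) : Prop :=
  (∀ y : Fin n → A, dist μ (fun ω t => Y t ω) y = ∏ t, dist μ (Y t) (y t)) ∧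
  (∀ t t' a, dist μ (Y t) a = dist μ (Y t') a)

/-- The prefix (Y_1, …, Y_{t-1}) of a process, as a single random variable. -/
def prefixRV {n : ℕ} {A : Type*} (Y : Fin n → Ω → A) (t : Fin n) : Ω → (Fin t.1 → A) :=
  fun ω s => Y (Fin.castLE t.isLt.le s) ω

end

theorem fe_pad {E ι : Type*} [AddCommGroup E] [Module ℝ E] [Fintype ι] {S : Set E} {n : ℕ}
    (hS : S.Nonempty) (hc : Fintype.card ι ≤ n) (z : ι → E) (w : ι → ℝ)
    (hz : ∀ i, z i ∈ S) (hw : ∀ i, 0 ≤ w i) :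
    ∃ (z' : Fin n → E) (w' : Fin n → ℝ), (∀ i, z' i ∈ S) ∧ (∀ i, 0 ≤ w' i) ∧
      ∑ i, w' i = ∑ i, w i ∧ ∑ i, w' i • z' i = ∑ i, w i • z i := by
  obtain ⟨s0, hs0⟩ := hS
  obtain ⟨f⟩ : Nonempty (ι ↪ Fin n) :=
    Function.Embedding.nonempty_of_card_le (by simpa using hc)
  have hf := f.injective
  refine ⟨Function.extend f z (fun _ => s0), Function.extend f w (fun _ => 0), ?_, ?_, ?_, ?_⟩
  · intro k
    by_cases hk : ∃ i, f i = k
    · obtain ⟨i, rfl⟩ := hk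
      rw [hf.extend_apply]; exact hz i
    · rw [Function.extend_apply' _ _ _ hk]; exact hs0
  · intro k
    by_cases hk : ∃ i, f i = k
    · obtain ⟨i, rfl⟩ := hk
      rw [hf.extend_apply]; exact hw i
    · rw [Function.extend_apply' _ _ _ hk]
  · symm
    apply Fintype.sum_of_injective f hf
    · intro k hk
      rw [Function.extend_apply' _ _ _ hk]
    · intro i
      rw [hf.extend_apply]
  · symm
    apply Fintype.sum_of_injective f hf
    · intro k hk
      rw [Function.extend_apply' _ _ _ hk, zero_smul]
    · intro i
      rw [hf.extend_apply, hf.extend_apply]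

theorem fenchel_eggleston {E : Type*} [NormedAddCommGroup E] [NormedSpace ℝ E]
    [FiniteDimensional ℝ E] {S : Set E} {n : ℕ} (hn : 1 ≤ n) (hdim : Module.finrank ℝ E = n + 1)
    (hS : IsPreconnected S) (φ : E →ₗ[ℝ] ℝ) (hφ : ∀ s ∈ S, φ s = 1) (x : E)
    (hx : x ∈ convexHull ℝ S) :
    ∃ (z : Fin n → E) (w : Fin n → ℝ), (∀ i, z i ∈ S) ∧ (∀ i, 0 ≤ w i) ∧
      ∑ i, w i = 1 ∧ ∑ i, w i • z i = x := by
  have hne : S.Nonempty := convexHull_nonempty_iff.mp ⟨x, hx⟩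
  obtain ⟨ι, _, z, w, hzS, hai, hw, hw1, hwx⟩ := eq_pos_convex_span_of_mem_convexHull hx
  have hzS' : ∀ i, z i ∈ S := fun i => hzS ⟨i, rfl⟩
  have hli : LinearIndependent ℝ z := by
    rw [Fintype.linearIndependent_iff]
    intro c hc i
    have h0 : ∑ i, c i = 0 := by
      have := congrArg φ hc
      simpa [hφ _ (hzS' _)] using this
    rw [affineIndependent_iff] at hai
    exact hai Finset.univ c h0 hc i (Finset.mem_univ i)
  have hcard := hli.fintype_card_le_finrank
  rw [hdim] at hcard
  rcases Nat.lt_or_ge n (Fintype.card ι) with hlt | hge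
  swap
  · obtain ⟨z', w', h1, h2, h3, h4⟩ := fe_pad hne hge z w hzS' (fun i => (hw i).le)
    exact ⟨z', w', h1, h2, h3.trans hw1, h4.trans hwx⟩
  have hceq : Fintype.card ι = n + 1 := by omega
  obtain ⟨i0, i1, h01⟩ := Fintype.exists_pair_of_one_lt_card (α := ι) (by omega)
  have : Nonempty ι := ⟨i0⟩
  let b := basisOfLinearIndependentOfCardEqFinrank hli (by rw [hceq, hdim])
  have hb : ∀ i, b i = z i := fun i => by simp [b]
  have hrep : ∀ s, ∑ i, b.repr s i • z i = s := by
    intro s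
    conv_rhs => rw [← b.sum_repr s]
    simp [hb]
  have hrep1 : ∀ s ∈ S, ∑ i, b.repr s i = 1 := by
    intro s hs
    have := congrArg φ (hrep s)
    simpa [hφ _ (hzS' _), hφ _ hs] using this
  have hcont : ∀ i, Continuous fun s => b.repr s i / w i := by
    intro i
    have : Continuous fun s => b.coord i s := LinearMap.continuous_of_finiteDimensional _
    exact this.div_const _
  have hcl : ∀ i, IsClosed {s | ∀ j, b.repr s j / w j ≤ b.repr s i / w i} := by
    intro i
    rw [Set.ofPred_forall]
    exact isClosed_iInter fun j => isClosed_le (hcont j) (hcont i)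
  have hself : ∀ i, ∀ j, b.repr (z i) j / w j ≤ b.repr (z i) i / w i := by
    intro i j
    rw [← hb i, b.repr_self]
    by_cases hij : i = j
    · subst hij; rfl
    · rw [Finsupp.single_eq_of_ne (Ne.symm hij)]
      simp [(hw i).le]
  have hkey := (isPreconnected_closed_iff.mp hS)
    {s | ∀ j, b.repr s j / w j ≤ b.repr s i0 / w i0}
    (⋃ i ∈ {i | i ≠ i0}, {s | ∀ j, b.repr s j / w j ≤ b.repr s i / w i})
    (hcl i0) ((Set.toFinite _).isClosed_biUnion fun i _ => hcl i)
    (by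
      intro s _
      obtain ⟨i, hi⟩ := Finite.exists_max (fun i => b.repr s i / w i)
      by_cases h : i = i0
      · subst h; exact Or.inl hi
      · right
        simp only [Set.mem_iUnion]
        exact ⟨i, h, hi⟩)
    ⟨z i0, hzS' _, hself i0⟩
    ⟨z i1, hzS' _, by
      simp only [Set.mem_iUnion]
      exact ⟨i1, h01.symm, hself i1⟩⟩
  obtain ⟨s, hs, hs0, hs1⟩ := hkey
  simp only [Set.mem_iUnion] at hs1
  obtain ⟨i, hi0, hi⟩ := hs1
  have hi0 : i ≠ i0 := hi0
  have hs0 : ∀ j, b.repr s j / w j ≤ b.repr s i0 / w i0 := hs0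
  have hi : ∀ j, b.repr s j / w j ≤ b.repr s i / w i := hi
  set M := b.repr s i0 / w i0 with hM
  have hMi : b.repr s i / w i = M := le_antisymm (hs0 i) (hi i0)
  have hle : ∀ j, b.repr s j ≤ M * w j := fun j => (div_le_iff₀ (hw j)).mp (hs0 j)
  have hMpos : 0 < M := by
    have : ∑ j, b.repr s j ≤ ∑ j, M * w j := Finset.sum_le_sum fun j _ => hle j
    rw [hrep1 s hs, ← Finset.mul_sum, hw1] at this
    linarith
  let v : ι → ℝ := fun j => w j - M⁻¹ * b.repr s j
  have hv : ∀ j, 0 ≤ v j := by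
    intro j
    have := mul_le_mul_of_nonneg_left (hle j) (inv_pos.mpr hMpos).le
    rw [← mul_assoc, inv_mul_cancel₀ hMpos.ne', one_mul] at this
    simp only [v]; linarith
  have hv0 : v i0 = 0 := by
    have : b.repr s i0 = M * w i0 := (div_eq_iff (hw i0).ne').mp hM.symm
    simp only [v]
    rw [this, ← mul_assoc, inv_mul_cancel₀ hMpos.ne']; ring
  have hvi : v i = 0 := by
    have : b.repr s i = M * w i := (div_eq_iff (hw i).ne').mp hMi
    simp only [v]
    rw [this, ← mul_assoc, inv_mul_cancel₀ hMpos.ne']; ring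
  have hvsum : ∑ j, v j = 1 - M⁻¹ := by
    simp only [v]
    rw [Finset.sum_sub_distrib, ← Finset.mul_sum, hrep1 s hs, hw1, mul_one]
  have hvz : ∑ j, v j • z j = x - M⁻¹ • s := by
    simp only [v, sub_smul, mul_smul]
    rw [Finset.sum_sub_distrib, ← Finset.smul_sum, hrep s, hwx]
  let z2 : ι → E := fun j => if j = i0 then s else z j
  let w2 : ι → ℝ := fun j => v j + if j = i0 then M⁻¹ else 0
  have hw2i : w2 i = 0 := by simp [w2, hvi, hi0]
  have hw2s : ∑ j, w2 j = 1 := by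
    simp only [w2]
    rw [Finset.sum_add_distrib, hvsum]; simp
  have hw2z : ∑ j, w2 j • z2 j = x := by
    have : ∀ j, w2 j • z2 j = v j • z j + if j = i0 then M⁻¹ • s else 0 := by
      intro j
      by_cases h : j = i0
      · subst h; simp [w2, z2, hv0]
      · simp [w2, z2, h]
    rw [Finset.sum_congr rfl fun j _ => this j, Finset.sum_add_distrib, hvz]; simp
  have hcs : Fintype.card {j // j ≠ i} ≤ n := by
    rw [Fintype.card_subtype_compl, hceq]; simp
  obtain ⟨z', w', h1, h2, h3, h4⟩ := fe_pad hne hcs (fun j => z2 j.1) (fun j => w2 j.1)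
    (by
      intro j; simp only [z2]; split_ifs
      · exact hs
      · exact hzS' _)
    (by
      intro j; simp only [w2]; have := hv j.1; have := (inv_pos.mpr hMpos).le
      split_ifs <;> linarith)
  refine ⟨z', w', h1, h2, h3.trans ?_, h4.trans ?_⟩
  · rw [← hw2s]
    apply Fintype.sum_of_injective _ Subtype.val_injective
    · intro k hk
      have : k = i := by simpa using hk
      rw [this, hw2i]
    · intro _; rfl
  · rw [← hw2z]
    apply Fintype.sum_of_injective _ Subtype.val_injective
    · intro k hk
      have : k = i := by simpa using hk
      rw [this, hw2i, zero_smul]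
    · intro _; rfl

theorem sl_dist_nonneg {Ω A : Type*} [Fintype Ω] [Fintype A] (μ : FinProb Ω) (X : Ω → A) (a : A) :
    0 ≤ dist μ X a := by
  unfold _root_.dist
  apply Finset.sum_nonneg
  intro ω _
  split_ifs
  · exact μ.nonneg ω
  · exact le_rfl

theorem sl_dist_comp {Ω A B : Type*} [Fintype Ω] [Fintype A] [Fintype B] (μ : FinProb Ω)
    (V : Ω → A) (f : A → B) (b : B) :
    dist μ (fun ω => f (V ω)) b = ∑ a, if f a = b then dist μ V a else 0 := by
  unfold _root_.dist
  have : ∀ a, (if f a = b then ∑ ω, (if V ω = a then μ.p ω else 0) else 0) =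
      ∑ ω, if V ω = a then (if f a = b then μ.p ω else 0) else 0 := by
    intro a
    by_cases h : f a = b <;> simp [h]
  simp only [this]
  rw [Finset.sum_comm]
  simp

theorem sl_dist_sum {Ω A : Type*} [Fintype Ω] [Fintype A] (μ : FinProb Ω) (X : Ω → A) :
    ∑ a, dist μ X a = 1 := by
  unfold _root_.dist
  rw [Finset.sum_comm]
  simp [μ.sum_one]

theorem sl_dist_marg {Ω A B : Type*} [Fintype Ω] [Fintype A] [Fintype B] (μ : FinProb Ω)
    (V : Ω → A) (U : Ω → B) (a : A) :
    dist μ V a = ∑ b, dist μ (fun ω => (V ω, U ω)) (a, b) := by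
  unfold _root_.dist
  rw [Finset.sum_comm]
  refine Finset.sum_congr rfl fun ω _ => ?_
  by_cases h : V ω = a <;> simp [h]

theorem sl_dist_marg' {Ω A B : Type*} [Fintype Ω] [Fintype A] [Fintype B] (μ : FinProb Ω)
    (V : Ω → A) (U : Ω → B) (b : B) :
    dist μ U b = ∑ a, dist μ (fun ω => (V ω, U ω)) (a, b) := by
  unfold _root_.dist
  rw [Finset.sum_comm]
  refine Finset.sum_congr rfl fun ω _ => ?_
  by_cases h : U ω = b <;> simp [h]

theorem sl_dist_congr {Ω A B : Type*} [Fintype Ω] [Fintype A] [Fintype B] (μ : FinProb Ω)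
    (V : Ω → A) (U : Ω → B) (a : A) (b : B) (h : ∀ ω, V ω = a ↔ U ω = b) :
    dist μ V a = dist μ U b := by
  unfold _root_.dist
  exact Finset.sum_congr rfl fun ω _ => by simp only [h ω]

noncomputable def slEta (x : ℝ) : ℝ := -(x * Real.logb 2 x)

theorem slEta_eq (x : ℝ) : slEta x = Real.negMulLog x / Real.log 2 := by
  simp only [slEta, Real.negMulLog, Real.logb]; ring

theorem slEta_mul (x y : ℝ) : slEta (x * y) = y * slEta x + x * slEta y := by
  simp only [slEta_eq, Real.negMulLog_mul]; ring

theorem slEta_cont : Continuous slEta := by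
  have : slEta = fun x => Real.negMulLog x / Real.log 2 := funext slEta_eq
  rw [this]
  exact Real.continuous_negMulLog.div_const _

theorem sl_MuI_eq {Ω G D : Type*} [Fintype Ω] [Fintype G] [Fintype D] (μ : FinProb Ω)
    (V : Ω → G) (U : Ω → D) (r : D → ℝ) (t : D → G → ℝ)
    (hJ : ∀ a u, dist μ (fun ω => (V ω, U ω)) (a, u) = r u * t u a)
    (ht : ∀ u, r u ≠ 0 → ∑ a, t u a = 1) :
    MuI μ V U = Hent μ V - ∑ u, r u * ∑ a, slEta (t u a) := by
  have hU : ∀ u, dist μ U u = r u := by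
    intro u
    rw [sl_dist_marg' μ V U u]
    simp only [hJ]
    rw [← Finset.mul_sum]
    by_cases h : r u = 0
    · simp [h]
    · rw [ht u h, mul_one]
  have h1 : Hent μ U = ∑ u, slEta (r u) := by
    simp only [Hent, hU, slEta]
  have h2 : Hent μ (fun ω => (V ω, U ω)) = ∑ u, slEta (r u) + ∑ u, r u * ∑ a, slEta (t u a) := by
    have : Hent μ (fun ω => (V ω, U ω)) = ∑ p : G × D, slEta (r p.2 * t p.2 p.1) := by
      unfold Hent
      refine Finset.sum_congr rfl fun p _ => ?_
      rw [← hJ p.1 p.2]; rfl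
    rw [this, Fintype.sum_prod_type_right, ← Finset.sum_add_distrib]
    refine Finset.sum_congr rfl fun u _ => ?_
    simp only [slEta_mul]
    rw [Finset.sum_add_distrib, ← Finset.sum_mul, ← Finset.mul_sum]
    by_cases h : r u = 0
    · simp [h, slEta]
    · rw [ht u h, one_mul]
  unfold MuI
  rw [h1, h2]; ring

noncomputable def slTau {T C G : Type*} [Fintype T] (c : T → C) (W : T → ℝ) (F : T → G)
    (q : C → ℝ) (a : G) : ℝ := ∑ t, if F t = a then W t * q (c t) else 0

noncomputable def slH {T C G : Type*} [Fintype T] [Fintype G] (c : T → C) (W : T → ℝ) (F : T → G)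
    (q : C → ℝ) : ℝ := ∑ a, slEta (slTau c W F q a)

theorem slH_cont {T C G : Type*} [Fintype T] [Fintype G] (c : T → C) (W : T → ℝ)
    (F : T → G) : Continuous (slH c W F) := by
  unfold slH
  refine continuous_finsetSum _ fun a _ => slEta_cont.comp ?_
  unfold slTau
  refine continuous_finsetSum _ fun t _ => ?_
  split_ifs
  · exact continuous_const.mul (continuous_apply _)
  · exact continuous_const

theorem sl_MuI_str {Ω T C G D : Type*} [Fintype Ω] [Fintype T] [Fintype G] [Fintype D]
    (μ : FinProb Ω) (V : Ω → T) (U : Ω → D) (c : T → C) (W : T → ℝ) (r : D → ℝ) (q : D → C → ℝ)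
    (hJ : ∀ t u, dist μ (fun ω => (V ω, U ω)) (t, u) = W t * (r u * q u (c t)))
    (hW : ∀ u, r u ≠ 0 → ∑ t, W t * q u (c t) = 1) (F : T → G) :
    MuI μ (fun ω => F (V ω)) U = Hent μ (fun ω => F (V ω)) - ∑ u, r u * slH c W F (q u) := by
  unfold slH
  apply sl_MuI_eq
  · intro a u
    rw [sl_dist_comp μ (fun ω => (V ω, U ω)) (fun p => (F p.1, p.2)) (a, u)]
    rw [Fintype.sum_prod_type]
    unfold slTau
    rw [Finset.mul_sum]
    refine Finset.sum_congr rfl fun t _ => ?_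
    simp only [hJ, Prod.mk.injEq]
    by_cases h : F t = a
    · simp only [h, true_and, if_true]
      rw [Finset.sum_ite_eq' Finset.univ u]
      simp only [Finset.mem_univ, if_true]; ring
    · simp [h]
  · intro u hu
    rw [← hW u hu]
    unfold slTau
    rw [Finset.sum_comm]
    simp

/-- fibrewise sum against the conditional law -/
theorem sl_fiber {T C : Type*} [Fintype T] [Fintype C] (c : T → C) (P : T → ℝ) (PY : C → ℝ)
    (hPY : ∀ y, PY y = ∑ t, if c t = y then P t else 0) (q : C → ℝ)
    (hq : ∀ y, PY y = 0 → q y = 0) :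
    ∑ t, P t / PY (c t) * q (c t) = ∑ y, q y := by
  have : ∀ t, P t / PY (c t) * q (c t) = ∑ y, (if c t = y then P t else 0) * (q y / PY y) := by
    intro t
    simp only [ite_mul, zero_mul]
    rw [Finset.sum_ite_eq]
    simp only [Finset.mem_univ, if_true]; ring
  simp only [this]
  rw [Finset.sum_comm]
  refine Finset.sum_congr rfl fun y _ => ?_
  rw [← Finset.sum_mul, ← hPY]
  by_cases h : PY y = 0
  · simp [h, hq y h]
  · field_simp

theorem sl_dist_law {Ω Ω' T G : Type*} [Fintype Ω] [Fintype Ω'] [Fintype T] [Fintype G]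
    (μ : FinProb Ω) (μ' : FinProb Ω') (V : Ω → T) (V' : Ω' → T)
    (h : ∀ t, dist μ' V' t = dist μ V t) (F : T → G) (g : G) :
    dist μ' (fun ω => F (V' ω)) g = dist μ (fun ω => F (V ω)) g := by
  rw [sl_dist_comp μ' V' F g, sl_dist_comp μ V F g]
  simp only [h]

theorem sl_Hent_law {Ω Ω' T G : Type*} [Fintype Ω] [Fintype Ω'] [Fintype T] [Fintype G]
    (μ : FinProb Ω) (μ' : FinProb Ω') (V : Ω → T) (V' : Ω' → T)
    (h : ∀ t, dist μ' V' t = dist μ V t) (F : T → G) :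
    Hent μ' (fun ω => F (V' ω)) = Hent μ (fun ω => F (V ω)) := by
  unfold Hent
  simp only [sl_dist_law μ μ' V V' h F]

/-- A pmf on a finite type is realised by a random variable on some `Fin m`. -/
theorem sl_realise {T : Type*} [Fintype T] (p : T → ℝ) (h0 : ∀ t, 0 ≤ p t) (h1 : ∑ t, p t = 1) :
    ∃ (m : ℕ) (μ : FinProb (Fin m)) (V : Fin m → T), ∀ t, dist μ V t = p t := by
  let e := Fintype.equivFin T
  refine ⟨Fintype.card T, ⟨fun i => p (e.symm i), fun i => h0 _, ?_⟩, e.symm, ?_⟩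
  · rw [← h1]; exact Equiv.sum_comp e.symm p
  · intro t
    unfold _root_.dist
    rw [Equiv.sum_comp e.symm (fun s => if s = t then p s else 0)]
    simp

/-- The optimisation step. -/
theorem sl_reduce {T A B C D : Type*} [Fintype T] [Fintype A] [Fintype B] [Fintype C] [Fintype D]
    (c : T → C) (W : T → ℝ) (F1 : T → A) (F2 : T → C) (F3 : T → B)
    (r : D → ℝ) (q : D → C → ℝ) (hr : ∀ u, 0 ≤ r u) (hr1 : ∑ u, r u = 1)
    (hq : ∀ u, q u ∈ stdSimplex ℝ C) :
    ∃ (r' : Fin (Fintype.card C + 2) → ℝ) (q' : Fin (Fintype.card C + 2) → C → ℝ),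
      (∀ u, 0 ≤ r' u) ∧ (∑ u, r' u = 1) ∧ (∀ u, q' u ∈ stdSimplex ℝ C) ∧
      (∀ y, ∑ u, r' u * q' u y = ∑ u, r u * q u y) ∧
      (∑ u, r' u * slH c W F1 (q' u) = ∑ u, r u * slH c W F1 (q u)) ∧
      (∑ u, r' u * slH c W F2 (q' u) = ∑ u, r u * slH c W F2 (q u)) ∧
      (∑ u, r' u * slH c W F3 (q' u) = ∑ u, r u * slH c W F3 (q u)) := by
  let g : (C → ℝ) → (C → ℝ) × ℝ × ℝ × ℝ :=
    fun q => (q, slH c W F1 q, slH c W F2 q, slH c W F3 q)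
  have hg : Continuous g := continuous_id.prodMk
    ((slH_cont c W F1).prodMk ((slH_cont c W F2).prodMk (slH_cont c W F3)))
  let φ : (C → ℝ) × ℝ × ℝ × ℝ →ₗ[ℝ] ℝ :=
    (∑ y, LinearMap.proj y) ∘ₗ LinearMap.fst ℝ (C → ℝ) (ℝ × ℝ × ℝ)
  have hpre : IsPreconnected (g '' stdSimplex ℝ C) :=
    (convex_stdSimplex ℝ C).isPreconnected.image g hg.continuousOn
  have hx : ∑ u, r u • g (q u) ∈ convexHull ℝ (g '' stdSimplex ℝ C) :=
    (convex_convexHull ℝ _).sum_mem (fun u _ => hr u) hr1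
      (fun u _ => subset_convexHull ℝ _ ⟨q u, hq u, rfl⟩)
  obtain ⟨z, w, hz, hw, hw1, hwx⟩ := fenchel_eggleston (n := Fintype.card C + 2) (by omega)
    (by simp) hpre φ (by
      rintro _ ⟨q, hq, rfl⟩
      simp [φ, g, hq.2]) _ hx
  choose q' hq' hgq using hz
  have hwx' : ∑ i, w i • g (q' i) = ∑ u, r u • g (q u) := by
    rw [← hwx]; simp only [hgq]
  refine ⟨w, q', hw, hw1, hq', ?_, ?_, ?_, ?_⟩
  · intro y
    have := congrFun (congrArg Prod.fst hwx') y
    simpa [g, Prod.fst_sum, Finset.sum_apply] using this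
  · have := congrArg (fun p => p.2.1) hwx'
    simpa [g, Prod.fst_sum, Prod.snd_sum] using this
  · have := congrArg (fun p => p.2.2.1) hwx'
    simpa [g, Prod.fst_sum, Prod.snd_sum] using this
  · have := congrArg (fun p => p.2.2.2) hwx'
    simpa [g, Prod.fst_sum, Prod.snd_sum] using this

theorem sl_MuI_transfer {Ω Ω' T C G D D' : Type*} [Fintype Ω] [Fintype Ω'] [Fintype T] [Fintype G]
    [Fintype D] [Fintype D'] (μ : FinProb Ω) (μ' : FinProb Ω') (V : Ω → T) (V' : Ω' → T)
    (U : Ω → D) (U' : Ω' → D') (c : T → C) (W : T → ℝ) (r : D → ℝ) (q : D → C → ℝ)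
    (r' : D' → ℝ) (q' : D' → C → ℝ)
    (hJ : ∀ t u, dist μ (fun ω => (V ω, U ω)) (t, u) = W t * (r u * q u (c t)))
    (hW : ∀ u, r u ≠ 0 → ∑ t, W t * q u (c t) = 1)
    (hJ' : ∀ t u, dist μ' (fun ω => (V' ω, U' ω)) (t, u) = W t * (r' u * q' u (c t)))
    (hW' : ∀ u, r' u ≠ 0 → ∑ t, W t * q' u (c t) = 1)
    (hlaw : ∀ t, dist μ' V' t = dist μ V t) (F : T → G)
    (h : ∑ u, r' u * slH c W F (q' u) = ∑ u, r u * slH c W F (q u)) :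
    MuI μ' (fun ω => F (V' ω)) U' = MuI μ (fun ω => F (V ω)) U := by
  rw [sl_MuI_str μ' V' U' c W r' q' hJ' hW' F, sl_MuI_str μ V U c W r q hJ hW F, h,
    sl_Hent_law μ μ' V V' hlaw F]

/-- Cardinality bound via the support lemma: any auxiliary U with Z − X − Y − U can be
replaced by U' on an alphabet of size |𝒴| + 2 (on a possibly different finite space
carrying the same joint law of (Z, X, Y)) preserving I(Z;U), I(Y;U) and I(X;U). -/
theorem support_lemma_cardinality {Ω A B C D : Type*} [Fintype Ω] [Fintype A]
    [Fintype B] [Fintype C] [Fintype D] (μ : FinProb Ω)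
    (Z : Ω → A) (X : Ω → B) (Y : Ω → C) (U : Ω → D)
    (hM : Markov4 μ Z X Y U) :
    ∃ (m : ℕ) (μ' : FinProb (Fin m)) (Z' : Fin m → A) (X' : Fin m → B)
      (Y' : Fin m → C) (U' : Fin m → Fin (Fintype.card C + 2)),
      (∀ z x y, dist μ' (fun ω => (Z' ω, X' ω, Y' ω)) (z, x, y) =
        dist μ (fun ω => (Z ω, X ω, Y ω)) (z, x, y)) ∧
      Markov4 μ' Z' X' Y' U' ∧
      MuI μ' Z' U' = MuI μ Z U ∧
      MuI μ' Y' U' = MuI μ Y U ∧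
      MuI μ' X' U' = MuI μ X U := by
  let T : Ω → A × B × C := fun ω => (Z ω, X ω, Y ω)
  let c : A × B × C → C := fun t => t.2.2
  let P : A × B × C → ℝ := dist μ T
  let PY : C → ℝ := dist μ Y
  let W : A × B × C → ℝ := fun t => P t / PY (c t)
  have hPY : ∀ y, PY y = ∑ t, if c t = y then P t else 0 := fun y => sl_dist_comp μ T c y
  have hP0 : ∀ t, 0 ≤ P t := fun t => sl_dist_nonneg μ T t
  have hPY0 : ∀ y, 0 ≤ PY y := fun y => sl_dist_nonneg μ Y y
  have hPYs : ∑ y, PY y = 1 := sl_dist_sum μ Y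
  have hPz : ∀ t, PY (c t) = 0 → P t = 0 := by
    intro t ht
    rw [hPY, Finset.sum_eq_zero_iff_of_nonneg
      (fun s _ => by split_ifs; exacts [hP0 s, le_rfl])] at ht
    simpa using ht t (Finset.mem_univ t)
  have hWP : ∀ t, W t * PY (c t) = P t := by
    intro t
    by_cases h : PY (c t) = 0
    · rw [h, hPz t h, mul_zero]
    · exact div_mul_cancel₀ _ h
  let r : D → ℝ := dist μ U
  have hr0 : ∀ u, 0 ≤ r u := fun u => sl_dist_nonneg μ U u
  let R : C → D → ℝ := fun y u => dist μ (fun ω => (Y ω, U ω)) (y, u)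
  have hR0 : ∀ y u, 0 ≤ R y u := fun y u => sl_dist_nonneg μ _ _
  have hRY : ∀ y, PY y = ∑ u, R y u := fun y => sl_dist_marg μ Y U y
  have hRU : ∀ u, r u = ∑ y, R y u := fun u => sl_dist_marg' μ Y U u
  let q : D → C → ℝ := fun u => if r u = 0 then PY else fun y => R y u / r u
  have hq : ∀ u, q u ∈ stdSimplex ℝ C := by
    intro u
    by_cases h : r u = 0
    · simp only [q, h, if_true]; exact ⟨hPY0, hPYs⟩
    · simp only [q, h, if_false]
      refine ⟨fun y => div_nonneg (hR0 y u) (hr0 u), ?_⟩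
      rw [← Finset.sum_div, ← hRU, div_self h]
  have hRq : ∀ y u, R y u = r u * q u y := by
    intro y u
    by_cases h : r u = 0
    · rw [h, zero_mul]
      have := hRU u
      rw [h] at this
      exact (Finset.sum_eq_zero_iff_of_nonneg (fun y _ => hR0 y u)).mp this.symm y
        (Finset.mem_univ y)
    · simp only [q, h, if_false]; field_simp
  obtain ⟨hM1, hM2⟩ := hM
  have hJ : ∀ t u, dist μ (fun ω => (T ω, U ω)) (t, u) = W t * (r u * q u (c t)) := by
    rintro ⟨a, b, y⟩ u
    rw [← hRq]
    have h := hM2 (a, b) y u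
    have e1 : dist μ (fun ω => ((Z ω, X ω), Y ω, U ω)) ((a, b), y, u) =
        dist μ (fun ω => (T ω, U ω)) ((a, b, y), u) :=
      sl_dist_congr μ _ _ _ _ fun ω => by simp [T, and_assoc]
    have e2 : dist μ (fun ω => ((Z ω, X ω), Y ω)) ((a, b), y) = P (a, b, y) :=
      sl_dist_congr μ _ _ _ _ fun ω => by simp [T, and_assoc]
    rw [e1, e2] at h
    have h : dist μ (fun ω => (T ω, U ω)) ((a, b, y), u) * PY y = P (a, b, y) * R y u := h
    by_cases hy : PY y = 0
    · have h1 : dist μ (fun ω => (T ω, U ω)) ((a, b, y), u) = 0 := by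
        have h2 : P (a, b, y) = ∑ u, dist μ (fun ω => (T ω, U ω)) ((a, b, y), u) :=
          sl_dist_marg μ T U _
        rw [hPz (a, b, y) hy] at h2
        exact (Finset.sum_eq_zero_iff_of_nonneg
          (fun u _ => sl_dist_nonneg μ _ _)).mp h2.symm u (Finset.mem_univ u)
      rw [h1]
      simp only [W, c, hy, div_zero, zero_mul]
    · simp only [W, c]
      field_simp
      exact h
  obtain ⟨r', q', hr', hr1', hq', hmix, hH1, hH2, hH3⟩ :=
    sl_reduce c W (fun t => t.1) (fun t => t.2.2) (fun t => t.2.1) r q hr0 (sl_dist_sum μ U) hq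
  have hmixY : ∀ y, ∑ u, r' u * q' u y = PY y := by
    intro y; rw [hmix, hRY]; simp only [hRq]
  have hW0 : ∀ t, 0 ≤ W t := fun t => div_nonneg (hP0 t) (hPY0 _)
  have hR'0 : ∀ u y, PY y = 0 → r' u * q' u y = 0 := by
    intro u y hy
    rw [← hmixY] at hy
    exact (Finset.sum_eq_zero_iff_of_nonneg
      (fun u _ => mul_nonneg (hr' u) ((hq' u).1 y))).mp hy u (Finset.mem_univ u)
  have hWq : ∀ u, r u ≠ 0 → ∑ t, W t * q u (c t) = 1 := by
    intro u hu
    rw [← (hq u).2]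
    refine sl_fiber c P PY hPY (q u) fun y hy => ?_
    have h1 : R y u = 0 := by
      rw [hRY] at hy
      exact (Finset.sum_eq_zero_iff_of_nonneg (fun u _ => hR0 y u)).mp hy u (Finset.mem_univ u)
    rw [hRq] at h1
    exact (mul_eq_zero.mp h1).resolve_left hu
  have hWq' : ∀ u, r' u ≠ 0 → ∑ t, W t * q' u (c t) = 1 := by
    intro u hu
    rw [← (hq' u).2]
    refine sl_fiber c P PY hPY (q' u) fun y hy => ?_
    exact (mul_eq_zero.mp (hR'0 u y hy)).resolve_left hu
  obtain ⟨m, μ', V, hV⟩ := sl_realise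
    (fun p : (A × B × C) × Fin (Fintype.card C + 2) => W p.1 * (r' p.2 * q' p.2 (c p.1)))
    (fun p => mul_nonneg (hW0 _) (mul_nonneg (hr' _) ((hq' _).1 _)))
    (by
      rw [Fintype.sum_prod_type_right, ← hr1']
      refine Finset.sum_congr rfl fun u _ => ?_
      by_cases hu : r' u = 0
      · simp [hu]
      · calc ∑ t, W t * (r' u * q' u (c t)) = r' u * ∑ t, W t * q' u (c t) := by
              rw [Finset.mul_sum]; exact Finset.sum_congr rfl fun t _ => by ring
          _ = r' u := by rw [hWq' u hu, mul_one])
  let T' : Fin m → A × B × C := fun ω => (V ω).1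
  let U' : Fin m → Fin (Fintype.card C + 2) := fun ω => (V ω).2
  have hJ' : ∀ t u, dist μ' (fun ω => (T' ω, U' ω)) (t, u) = W t * (r' u * q' u (c t)) :=
    fun t u => hV (t, u)
  have hlaw : ∀ t, dist μ' T' t = dist μ T t := by
    intro t
    rw [sl_dist_marg μ' T' U' t]
    simp only [hJ']
    rw [← Finset.mul_sum, hmixY, hWP]
  refine ⟨m, μ', fun ω => (T' ω).1, fun ω => (T' ω).2.1, fun ω => (T' ω).2.2, U',
    fun z x y => hlaw (z, x, y), ⟨?_, ?_⟩, ?_, ?_, ?_⟩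
  · rintro a b ⟨y, u⟩
    have e1 : dist μ' (fun ω => ((T' ω).1, (T' ω).2.1, (T' ω).2.2, U' ω)) (a, b, y, u) =
        W (a, b, y) * (r' u * q' u y) := by
      rw [← hJ' (a, b, y) u]
      exact sl_dist_congr μ' _ _ _ _ fun ω => by simp [Prod.ext_iff, and_assoc]
    have e2 : dist μ' (fun ω => ((T' ω).2.1, (T' ω).2.2, U' ω)) (b, y, u) =
        (∑ a, W (a, b, y)) * (r' u * q' u y) := by
      rw [sl_dist_marg' μ' (fun ω => (T' ω).1), Finset.sum_mul]
      refine Finset.sum_congr rfl fun a _ => ?_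
      rw [← hJ' (a, b, y) u]
      exact sl_dist_congr μ' _ _ _ _ fun ω => by simp [Prod.ext_iff, and_assoc]
    have e3 : dist μ' (fun ω => (T' ω).2.1) b = dist μ X b :=
      sl_dist_law μ μ' T T' hlaw (fun t => t.2.1) b
    have e4 : dist μ' (fun ω => ((T' ω).1, (T' ω).2.1)) (a, b) =
        dist μ (fun ω => (Z ω, X ω)) (a, b) :=
      sl_dist_law μ μ' T T' hlaw (fun t => (t.1, t.2.1)) (a, b)
    have key : P (a, b, y) * dist μ X b =
        dist μ (fun ω => (Z ω, X ω)) (a, b) * ∑ a, P (a, b, y) := by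
      have f1 : P (a, b, y) = ∑ u, dist μ (fun ω => (Z ω, X ω, Y ω, U ω)) (a, b, y, u) := by
        have : P (a, b, y) = ∑ u, dist μ (fun ω => (T ω, U ω)) ((a, b, y), u) :=
          sl_dist_marg μ T U _
        rw [this]
        refine Finset.sum_congr rfl fun u _ => ?_
        exact sl_dist_congr μ _ _ _ _ fun ω => by simp [T, and_assoc]
      have f2 : ∑ a, P (a, b, y) = ∑ u, dist μ (fun ω => (X ω, Y ω, U ω)) (b, y, u) := by
        have g1 : ∑ a, P (a, b, y) = dist μ (fun ω => (X ω, Y ω)) (b, y) :=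
          (sl_dist_marg' μ Z (fun ω => (X ω, Y ω)) (b, y)).symm
        rw [g1, sl_dist_marg μ (fun ω => (X ω, Y ω)) U]
        refine Finset.sum_congr rfl fun u _ => ?_
        exact sl_dist_congr μ _ _ _ _ fun ω => by simp [and_assoc]
      rw [f1, f2, Finset.sum_mul, Finset.mul_sum]
      exact Finset.sum_congr rfl fun u _ => hM1 a b (y, u)
    have key2 : W (a, b, y) * dist μ X b =
        dist μ (fun ω => (Z ω, X ω)) (a, b) * ∑ a, W (a, b, y) := by
      simp only [W, c]
      rw [← Finset.sum_div, div_mul_eq_mul_div, key, mul_div_assoc]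
    rw [e1, e2, e3, e4]
    linear_combination (r' u * q' u y) * key2
  · rintro ⟨a, b⟩ y u
    have e1 : dist μ' (fun ω => (((T' ω).1, (T' ω).2.1), (T' ω).2.2, U' ω)) ((a, b), y, u) =
        W (a, b, y) * (r' u * q' u y) := by
      rw [← hJ' (a, b, y) u]
      exact sl_dist_congr μ' _ _ _ _ fun ω => by simp [Prod.ext_iff, and_assoc]
    have e2 : dist μ' (fun ω => (((T' ω).1, (T' ω).2.1), (T' ω).2.2)) ((a, b), y) =
        P (a, b, y) := by
      refine Eq.trans ?_ (hlaw (a, b, y))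
      exact sl_dist_congr μ' _ _ _ _ fun ω => by simp [Prod.ext_iff, and_assoc]
    have e3 : dist μ' (fun ω => (T' ω).2.2) y = PY y :=
      sl_dist_law μ μ' T T' hlaw (fun t => t.2.2) y
    have e4 : dist μ' (fun ω => ((T' ω).2.2, U' ω)) (y, u) = r' u * q' u y := by
      rw [sl_dist_comp μ' (fun ω => (T' ω, U' ω)) (fun p => (c p.1, p.2)) (y, u),
        Fintype.sum_prod_type]
      have hf := sl_fiber c P PY hPY (fun y' => if y' = y then r' u * q' u y else 0)
        (fun y' hy' => by
          by_cases h : y' = y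
          · subst h; simp only [if_true]; exact hR'0 u y' hy'
          · simp [h])
      refine (Finset.sum_congr rfl fun t _ => ?_).trans (hf.trans (by simp))
      simp only [hJ', Prod.mk.injEq]
      by_cases h : c t = y
      · simp only [h, true_and, if_true]
        rw [Finset.sum_ite_eq' Finset.univ u]
        simp [W, h]
      · simp [h]
    rw [e1, e2, e3, e4, ← hWP (a, b, y)]
    ring
  · exact sl_MuI_transfer μ μ' T T' U U' c W r q r' q' hJ hWq hJ' hWq' hlaw (fun t => t.1) hH1
  · exact sl_MuI_transfer μ μ' T T' U U' c W r q r' q' hJ hWq hJ' hWq' hlaw (fun t => t.2.2) hH2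
  · exact sl_MuI_transfer μ μ' T T' U U' c W r q r' q' hJ hWq hJ' hWq' hlaw (fun t => t.2.1) hH3
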